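/- arXiv:1306.2707 — 4 statements merged into one kernel-verified Lean document; each statement's English description precedes it below -/
import Mathlib

section
/- Let g ≥ 1 and 1 ≤ h ≤ ⌊g/2⌋. The sequence w'_{2,h} = (2g+1, …, 1) ⧺ (2g−2h+1, …, 2g+1) ⧺ (2g−2h, …, 2g) ⧺ ⋯ ⧺ (1, …, 2h+1) ⧺ ((1, …, 2h) repeated 4h+2 times) ⧺ (2h+1, …, 1) ⧺ (2h+2, …, 2) ⧺ ⋯ ⧺ (2g+1, …, 2g−2h+1) ⧺ (1, …, 2g+1) can be obtained from the sequence (1, …, 2g+1, 2g+1, …, 1) repeated 2(h+1) times by finitely many H1-, H2-, and H3-moves, their inverses, and cyclic permutations of the sequence. -/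
/-- Concatenation of k copies of a list. -/
def repL {α : Type*} (k : ℕ) (w : List α) : List α := (List.replicate k w).flatten

/-- H1-, H2- and H3-moves on sequences with entries in {1, …, 2g+1}. -/
inductive NStep (g : ℕ) : List ℕ → List ℕ → Prop
  | h1 (l₁ l₂ : List ℕ) (i j : ℕ) : 1 ≤ i → i ≤ 2*g+1 → 1 ≤ j → j ≤ 2*g+1 →
      (i+2 ≤ j ∨ j+2 ≤ i) →
      NStep g (l₁ ++ [i, j] ++ l₂) (l₁ ++ [j, i] ++ l₂)
  | h2 (l₁ l₂ : List ℕ) (i j : ℕ) : 1 ≤ i → i ≤ 2*g+1 → 1 ≤ j → j ≤ 2*g+1 →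
      (i+1 = j ∨ j+1 = i) →
      NStep g (l₁ ++ [i, j, i] ++ l₂) (l₁ ++ [j, i, j] ++ l₂)
  | h3 (l₁ l₂ : List ℕ) (i : ℕ) : 1 ≤ i → i ≤ 2*g+1 →
      NStep g (l₁ ++ (List.range' 1 (2*g+1) ++ (List.range' 1 (2*g+1)).reverse ++ [i]) ++ l₂)
              (l₁ ++ ([i] ++ List.range' 1 (2*g+1) ++ (List.range' 1 (2*g+1)).reverse) ++ l₂)

/-- Ascending blocks (2g−2h+1,…,2g+1), (2g−2h,…,2g), …, (1,…,2h+1). -/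
def ascBlocks (g h : ℕ) : List ℕ :=
  ((List.range (2*g-2*h+1)).map fun k => List.range' (2*g-2*h+1-k) (2*h+1)).flatten

/-- Descending blocks (2h+1,…,1), (2h+2,…,2), …, (2g+1,…,2g−2h+1). -/
def descBlocks (g h : ℕ) : List ℕ :=
  ((List.range (2*g-2*h+1)).map fun k => (List.range' (k+1) (2*h+1)).reverse).flatten

/-- The sequence w'_{2,h}. -/
def w2hSeq (g h : ℕ) : List ℕ :=
  (List.range' 1 (2*g+1)).reverse ++ ascBlocks g h ++
    repL (4*h+2) (List.range' 1 (2*h)) ++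
    descBlocks g h ++ List.range' 1 (2*g+1)

/-! ### Braid-type identities in an abstract monoid -/
section Abstract

variable {M : Type*} [Monoid M]

/-- s k * s (k+1) * ... (m factors). -/
def upW (s : ℕ → M) (k m : ℕ) : M := ((List.range' k m).map s).prod

/-- s (k+m-1) * ... * s k (m factors). -/
def dnW (s : ℕ → M) (k m : ℕ) : M := ((List.range' k m).reverse.map s).prod

/-- Ascending blocks. -/
def ascW (s : ℕ → M) (a : ℕ) : ℕ → M
  | 0 => 1
  | b+1 => upW s (b+1) a * ascW s a b

/-- Descending blocks. -/
def descW (s : ℕ → M) (a : ℕ) : ℕ → M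
  | 0 => 1
  | b+1 => descW s a b * dnW s (b+1) a

/-- The full twist on a strands. -/
def twW (s : ℕ → M) : ℕ → M
  | 0 => 1
  | a+1 => twW s a * (dnW s 1 a * upW s 1 a)

/-- The product of the elements D_1, ..., D_a. -/
def pdW (s : ℕ → M) (N : ℕ) : ℕ → M
  | 0 => 1
  | a+1 => pdW s N a * (upW s (a+1) (N-a) * dnW s (a+1) (N-a))

variable (s : ℕ → M)

lemma upW_zero (k : ℕ) : upW s k 0 = 1 := by simp [upW]
lemma dnW_zero (k : ℕ) : dnW s k 0 = 1 := by simp [dnW]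

lemma upW_add (k m n : ℕ) : upW s k (m+n) = upW s k m * upW s (k+m) n := by
  simp only [upW]
  rw [← List.range'_append_1, List.map_append, List.prod_append]

lemma dnW_add (k m n : ℕ) : dnW s k (m+n) = dnW s (k+m) n * dnW s k m := by
  simp only [dnW]
  rw [← List.range'_append_1, List.reverse_append, List.map_append, List.prod_append]

lemma upW_one (k : ℕ) : upW s k 1 = s k := by simp [upW]
lemma dnW_one (k : ℕ) : dnW s k 1 = s k := by simp [dnW]

lemma upW_succ (k m : ℕ) : upW s k (m+1) = upW s k m * s (k+m) := by
  rw [upW_add, upW_one]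
lemma upW_succ' (k m : ℕ) : upW s k (m+1) = s k * upW s (k+1) m := by
  rw [add_comm m 1, upW_add, upW_one]
lemma dnW_succ (k m : ℕ) : dnW s k (m+1) = s (k+m) * dnW s k m := by
  rw [dnW_add, dnW_one]
lemma dnW_succ' (k m : ℕ) : dnW s k (m+1) = dnW s (k+1) m * s k := by
  rw [add_comm m 1, dnW_add, dnW_one]

lemma commute_upW (x : M) (k m : ℕ) (h : ∀ i, k ≤ i → i < k+m → Commute x (s i)) :
    Commute x (upW s k m) := by
  induction m with
  | zero => rw [upW_zero]; exact Commute.one_right x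
  | succ m ih =>
    rw [upW_succ]
    exact (ih fun i h1 h2 => h i h1 (by omega)).mul_right (h _ (by omega) (by omega))

lemma commute_dnW (x : M) (k m : ℕ) (h : ∀ i, k ≤ i → i < k+m → Commute x (s i)) :
    Commute x (dnW s k m) := by
  induction m with
  | zero => rw [dnW_zero]; exact Commute.one_right x
  | succ m ih =>
    rw [dnW_succ]
    exact (h _ (by omega) (by omega)).mul_right (ih fun i h1 h2 => h i h1 (by omega))

lemma commute_ascW (x : M) (a b : ℕ) (h : ∀ i, 1 ≤ i → i < a+b → Commute x (s i)) :
    Commute x (ascW s a b) := by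
  induction b with
  | zero => exact Commute.one_right x
  | succ b ih =>
    exact (commute_upW s x _ _ fun i h1 h2 => h i (by omega) (by omega)).mul_right
      (ih fun i h1 h2 => h i h1 (by omega))

lemma commute_descW (x : M) (a b : ℕ) (h : ∀ i, 1 ≤ i → i < a+b → Commute x (s i)) :
    Commute x (descW s a b) := by
  induction b with
  | zero => exact Commute.one_right x
  | succ b ih =>
    exact (ih fun i h1 h2 => h i h1 (by omega)).mul_right
      (commute_dnW s x _ _ fun i h1 h2 => h i (by omega) (by omega))

lemma commute_twW (x : M) (a : ℕ) (h : ∀ i, 1 ≤ i → i < a → Commute x (s i)) :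
    Commute x (twW s a) := by
  induction a with
  | zero => exact Commute.one_right x
  | succ a ih =>
    exact (ih fun i h1 h2 => h i h1 (by omega)).mul_right
      ((commute_dnW s x _ _ fun i h1 h2 => h i (by omega) (by omega)).mul_right
      (commute_upW s x _ _ fun i h1 h2 => h i (by omega) (by omega)))

lemma far (hc : ∀ i j, i+2 ≤ j → s i * s j = s j * s i) (i j : ℕ) (h : i+2 ≤ j ∨ j+2 ≤ i) : Commute (s i) (s j) := by
  rcases h with h | h
  · exact hc i j h
  · exact (hc j i h).symm

lemma upW_mul (hc : ∀ i j, i+2 ≤ j → s i * s j = s j * s i)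
    (hb : ∀ i, s i * s (i+1) * s i = s (i+1) * s i * s (i+1))
    (k m j : ℕ) (h1 : k ≤ j) (h2 : j+1 < k+m) :
    upW s k m * s j = s (j+1) * upW s k m := by
  obtain ⟨p, rfl⟩ : ∃ p, j = k+p := ⟨j-k, by omega⟩
  obtain ⟨q, rfl⟩ : ∃ q, m = p + (1 + (1 + q)) := ⟨m-p-2, by omega⟩
  have e1 : Commute (s (k+p)) (upW s (k+p+1+1) q) :=
    commute_upW s _ _ _ fun i h1 h2 => far s hc _ _ (by omega)
  have e2 : Commute (s (k+p+1)) (upW s k p) :=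
    commute_upW s _ _ _ fun i h1 h2 => far s hc _ _ (by omega)
  simp only [upW_add, upW_one]
  calc _ = upW s k p * (s (k+p) * (s (k+p+1) * (upW s (k+p+1+1) q * s (k+p)))) := by
        simp only [mul_assoc]
    _ = upW s k p * (s (k+p) * s (k+p+1) * s (k+p)) * upW s (k+p+1+1) q := by
        rw [← e1.eq]; simp only [mul_assoc]
    _ = (upW s k p * s (k+p+1)) * s (k+p) * s (k+p+1) * upW s (k+p+1+1) q := by
        rw [hb]; simp only [mul_assoc]
    _ = _ := by rw [← e2.eq]; simp only [mul_assoc]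

lemma dnW_mul (hc : ∀ i j, i+2 ≤ j → s i * s j = s j * s i)
    (hb : ∀ i, s i * s (i+1) * s i = s (i+1) * s i * s (i+1))
    (k m j : ℕ) (h1 : k ≤ j) (h2 : j+1 < k+m) :
    dnW s k m * s (j+1) = s j * dnW s k m := by
  obtain ⟨p, rfl⟩ : ∃ p, j = k+p := ⟨j-k, by omega⟩
  obtain ⟨q, rfl⟩ : ∃ q, m = p + (1 + (1 + q)) := ⟨m-p-2, by omega⟩
  have e1 : Commute (s (k+p)) (dnW s (k+p+1+1) q) :=
    commute_dnW s _ _ _ fun i h1 h2 => far s hc _ _ (by omega)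
  have e2 : Commute (s (k+p+1)) (dnW s k p) :=
    commute_dnW s _ _ _ fun i h1 h2 => far s hc _ _ (by omega)
  simp only [dnW_add, dnW_one]
  calc _ = dnW s (k+p+1+1) q * (s (k+p+1) * (s (k+p) * (dnW s k p * s (k+p+1)))) := by
        simp only [mul_assoc]
    _ = dnW s (k+p+1+1) q * (s (k+p+1) * s (k+p) * s (k+p+1)) * dnW s k p := by
        rw [← e2.eq]; simp only [mul_assoc]
    _ = (dnW s (k+p+1+1) q * s (k+p)) * s (k+p+1) * s (k+p) * dnW s k p := by
        rw [← hb]; simp only [mul_assoc]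
    _ = _ := by rw [← e1.eq]; simp only [mul_assoc]

lemma upW_mul_upW (hc : ∀ i j, i+2 ≤ j → s i * s j = s j * s i)
    (hb : ∀ i, s i * s (i+1) * s i = s (i+1) * s i * s (i+1))
    (k m j n : ℕ) (h1 : k ≤ j) (h2 : j+n < k+m) :
    upW s k m * upW s j n = upW s (j+1) n * upW s k m := by
  induction n with
  | zero => simp [upW_zero]
  | succ n ih =>
    rw [upW_succ, ← mul_assoc, ih (by omega), mul_assoc, upW_mul s hc hb k m _ (by omega) (by omega),
      upW_succ, mul_assoc, show j+n+1 = j+1+n by omega]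

lemma upW_mul_dnW (hc : ∀ i j, i+2 ≤ j → s i * s j = s j * s i)
    (hb : ∀ i, s i * s (i+1) * s i = s (i+1) * s i * s (i+1))
    (k m j n : ℕ) (h1 : k ≤ j) (h2 : j+n < k+m) :
    upW s k m * dnW s j n = dnW s (j+1) n * upW s k m := by
  induction n with
  | zero => simp [dnW_zero]
  | succ n ih =>
    rw [dnW_succ, ← mul_assoc, upW_mul s hc hb k m _ (by omega) (by omega), mul_assoc,
      ih (by omega), dnW_succ, mul_assoc, show j+n+1 = j+1+n by omega]

lemma step1 (hc : ∀ i j, i+2 ≤ j → s i * s j = s j * s i)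
    (hb : ∀ i, s i * s (i+1) * s i = s (i+1) * s i * s (i+1))
    (a c : ℕ) :
    ascW s a (c+1) * upW s (a+1) c = upW s 1 c * ascW s a (c+1) := by
  induction c with
  | zero => simp [upW_zero]
  | succ c ih =>
    have e1 : Commute (upW s (c+1+1) a) (upW s 1 c) :=
      commute_upW s _ _ _ fun i h1 h2 =>
        (commute_upW s _ _ _ fun j h3 h4 => far s hc _ _ (by omega)).symm
    have e2 : Commute (s (a+c+1)) (ascW s a c) :=
      commute_ascW s _ _ _ fun i h1 h2 => far s hc _ _ (by omega)
    have e3 : upW s (c+1) (a+1) * upW s (c+1) a = upW s (c+1+1) a * upW s (c+1) (a+1) :=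
      upW_mul_upW s hc hb _ _ _ _ le_rfl (by omega)
    calc ascW s a (c+1+1) * upW s (a+1) (c+1)
        = upW s (c+1+1) a * (ascW s a (c+1) * upW s (a+1) c) * s (a+c+1) := by
          rw [upW_succ, show a+1+c = a+c+1 by omega]; simp only [ascW, mul_assoc]
      _ = (upW s (c+1+1) a * upW s 1 c) * upW s (c+1) a * (ascW s a c * s (a+c+1)) := by
          rw [ih]; simp only [ascW, mul_assoc]
      _ = upW s 1 c * (upW s (c+1+1) a * (upW s (c+1) a * s (c+1+a))) * ascW s a c := by
          rw [e1.eq, ← e2.eq, show c+1+a = a+c+1 by omega]; simp only [mul_assoc]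
      _ = upW s 1 c * (upW s (c+1) (a+1) * upW s (c+1) a) * ascW s a c := by
          rw [← upW_succ, e3]
      _ = _ := by
          rw [upW_succ' s (c+1) a, upW_succ s 1 c, add_comm 1 c]; simp only [ascW, mul_assoc]

lemma step2 (hc : ∀ i j, i+2 ≤ j → s i * s j = s j * s i)
    (hb : ∀ i, s i * s (i+1) * s i = s (i+1) * s i * s (i+1))
    (a c : ℕ) : ascW s a c * dnW s (a+1) c = ascW s (a+1) c := by
  induction c with
  | zero => simp [dnW_zero, ascW]
  | succ c ih =>
    have e2 : Commute (s (a+1+c)) (ascW s a c) :=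
      commute_ascW s _ _ _ fun i h1 h2 => far s hc _ _ (by omega)
    calc ascW s a (c+1) * dnW s (a+1) (c+1)
        = upW s (c+1) a * (ascW s a c * s (a+1+c)) * dnW s (a+1) c := by
          rw [dnW_succ]; simp only [ascW, mul_assoc]
      _ = upW s (c+1) a * s (c+1+a) * (ascW s a c * dnW s (a+1) c) := by
          rw [← e2.eq, show c+1+a = a+1+c by omega]; simp only [mul_assoc]
      _ = _ := by rw [ih, ← upW_succ]; simp only [ascW]

lemma step3 (hc : ∀ i j, i+2 ≤ j → s i * s j = s j * s i)
    (hb : ∀ i, s i * s (i+1) * s i = s (i+1) * s i * s (i+1))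
    (a c : ℕ) : upW s 1 a * descW s (a+1) c = upW s 1 (a+c) * descW s a c := by
  induction c with
  | zero => simp [descW]
  | succ c ih =>
    have e2 : Commute (s (c+1+a)) (descW s a c) :=
      commute_descW s _ _ _ fun i h1 h2 => far s hc _ _ (by omega)
    calc upW s 1 a * descW s (a+1) (c+1)
        = (upW s 1 a * descW s (a+1) c) * dnW s (c+1) (a+1) := by
          simp only [descW, mul_assoc]
      _ = upW s 1 (a+c) * (descW s a c * s (c+1+a)) * dnW s (c+1) a := by
          rw [ih, dnW_succ]; simp only [mul_assoc]
      _ = upW s 1 (a+c) * s (1+(a+c)) * (descW s a c * dnW s (c+1) a) := by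
          rw [← e2.eq, show c+1+a = 1+(a+c) by omega]; simp only [mul_assoc]
      _ = _ := by rw [← upW_succ]; simp only [descW]; rfl

lemma step4 (hc : ∀ i j, i+2 ≤ j → s i * s j = s j * s i)
    (hb : ∀ i, s i * s (i+1) * s i = s (i+1) * s i * s (i+1))
    (a L c : ℕ) (h : a+c ≤ L) :
    dnW s 1 a * upW s 1 L * descW s a c = descW s a (c+1) * upW s 1 L := by
  induction c with
  | zero => simp [descW]
  | succ c ih =>
    calc dnW s 1 a * upW s 1 L * descW s a (c+1)
        = (dnW s 1 a * upW s 1 L * descW s a c) * dnW s (c+1) a := by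
          simp only [descW, mul_assoc]
      _ = descW s a (c+1) * (upW s 1 L * dnW s (c+1) a) := by
          rw [ih (by omega)]; simp only [mul_assoc]
      _ = _ := by
          rw [upW_mul_dnW s hc hb _ _ _ _ (by omega) (by omega)]
          simp only [descW, mul_assoc]

lemma stepP (hc : ∀ i j, i+2 ≤ j → s i * s j = s j * s i)
    (hb : ∀ i, s i * s (i+1) * s i = s (i+1) * s i * s (i+1))
    (a c : ℕ) :
    descW s a (c+1) * ascW s a (c+1) * (upW s (a+1) c * dnW s (a+1) c)
      = dnW s 1 a * upW s 1 a * descW s (a+1) c * ascW s (a+1) c := by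
  calc _ = descW s a (c+1) * (ascW s a (c+1) * upW s (a+1) c) * dnW s (a+1) c := by
        simp only [mul_assoc]
    _ = descW s a (c+1) * upW s 1 c * upW s (c+1) a * (ascW s a c * dnW s (a+1) c) := by
        rw [step1 s hc hb]; simp only [ascW, mul_assoc]
    _ = descW s a (c+1) * upW s 1 (a+c) * ascW s (a+1) c := by
        rw [step2 s hc hb, add_comm a c, upW_add, add_comm 1 c]; simp only [mul_assoc]
    _ = dnW s 1 a * (upW s 1 a * descW s (a+1) c) * ascW s (a+1) c := by
        rw [← step4 s hc hb a (a+c) c le_rfl, step3 s hc hb]; simp only [mul_assoc]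
    _ = _ := by simp only [mul_assoc]

lemma pdW_eq (hc : ∀ i j, i+2 ≤ j → s i * s j = s j * s i)
    (hb : ∀ i, s i * s (i+1) * s i = s (i+1) * s i * s (i+1))
    (N a b : ℕ) (h : a + b = N + 1) :
    pdW s N a = twW s a * (descW s a b * ascW s a b) := by
  induction a generalizing b with
  | zero =>
    have h1 : ∀ b, descW s 0 b = 1 := by
      intro b; induction b with
      | zero => rfl
      | succ b ih => simp [descW, ih, dnW_zero]
    have h2 : ∀ b, ascW s 0 b = 1 := by
      intro b; induction b with
      | zero => rfl
      | succ b ih => simp [ascW, ih, upW_zero]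
    simp [pdW, twW, h1, h2]
  | succ a ih =>
    have : N - a = b := by omega
    simp only [pdW, twW]
    rw [ih (b+1) (by omega), this, mul_assoc, stepP s hc hb]
    simp only [mul_assoc]

lemma twist_aux (hc : ∀ i j, i+2 ≤ j → s i * s j = s j * s i)
    (hb : ∀ i, s i * s (i+1) * s i = s (i+1) * s i * s (i+1))
    (a k : ℕ) (h : k ≤ a+1) :
    upW s 1 (a+1) ^ k = upW s 1 a ^ k * dnW s (a+2-k) k := by
  induction k with
  | zero => simp [dnW_zero]
  | succ k ih =>
    have e : upW s 1 (a+1) * dnW s (a+2-(k+1)) k = dnW s (a+2-k) k * upW s 1 (a+1) := by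
      rw [upW_mul_dnW s hc hb _ _ _ _ (by omega) (by omega),
        show a+2-(k+1)+1 = a+2-k by omega]
    rw [pow_succ, ih (by omega), mul_assoc, ← e, upW_succ, pow_succ, dnW_succ,
      show a+2-(k+1)+k = 1+a by omega]
    simp only [mul_assoc]

lemma twW_eq (hc : ∀ i j, i+2 ≤ j → s i * s j = s j * s i)
    (hb : ∀ i, s i * s (i+1) * s i = s (i+1) * s i * s (i+1))
    (a : ℕ) : twW s (a+1) = upW s 1 a ^ (a+1) := by
  induction a with
  | zero => simp [twW, upW_zero, dnW_zero]
  | succ a ih =>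
    rw [twW, ih, pow_succ (upW s 1 (a+1)), twist_aux s hc hb a (a+1) le_rfl,
      show a+2-(a+1) = 1 by omega, mul_assoc]

lemma twW_succ' (hc : ∀ i j, i+2 ≤ j → s i * s j = s j * s i)
    (hb : ∀ i, s i * s (i+1) * s i = s (i+1) * s i * s (i+1))
    (a : ℕ) : twW s (a+1) = dnW s 1 a * upW s 1 a * twW s a := by
  rw [twW]
  refine (commute_twW s (dnW s 1 a * upW s 1 a) a fun i h1 h2 => ?_).symm.eq
  show _ = _
  rw [mul_assoc, upW_mul s hc hb _ _ _ h1 (by omega), ← mul_assoc,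
    dnW_mul s hc hb _ _ _ h1 (by omega), mul_assoc]

lemma pdW_mul_twW (hc : ∀ i j, i+2 ≤ j → s i * s j = s j * s i)
    (hb : ∀ i, s i * s (i+1) * s i = s (i+1) * s i * s (i+1))
    (N a : ℕ) (h : a ≤ N + 1) (hC : ∀ i, 1 ≤ i → i ≤ N →
    Commute (upW s 1 N * dnW s 1 N) (s i)) :
    pdW s N a * twW s a = (upW s 1 N * dnW s 1 N) ^ a := by
  induction a with
  | zero => simp [pdW, twW]
  | succ a ih =>
    obtain ⟨c, rfl⟩ : ∃ c, N = a + c := ⟨N-a, by omega⟩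
    have hu : Commute (upW s 1 (a+c) * dnW s 1 (a+c)) (upW s 1 a) :=
      commute_upW s _ _ _ fun i h1 h2 => hC i h1 (by omega)
    have ht : Commute (upW s 1 (a+c) * dnW s 1 (a+c)) (twW s a) :=
      commute_twW s _ _ fun i h1 h2 => hC i h1 (by omega)
    have hQ : ∃ Q, pdW s (a+c) a = Q * upW s 1 a := by
      rw [pdW_eq s hc hb (a+c) a (c+1) (by omega)]
      have : ∀ c, ∃ Q, ascW s a (c+1) = Q * upW s 1 a := by
        intro c
        induction c with
        | zero => exact ⟨1, by simp [ascW]⟩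
        | succ c ih =>
          obtain ⟨Q, hQ⟩ := ih
          exact ⟨upW s (c+1+1) a * Q, by rw [ascW, hQ, mul_assoc]⟩
      obtain ⟨Q, hQ⟩ := this c
      exact ⟨twW s a * (descW s a (c+1) * Q), by rw [hQ]; simp only [mul_assoc]⟩
    obtain ⟨Q, hQ⟩ := hQ
    have e1 : upW s 1 a * upW s (a+1) c = upW s 1 (a+c) := by
      rw [upW_add, add_comm 1 a]
    have e2 : dnW s (a+1) c * dnW s 1 a = dnW s 1 (a+c) := by
      rw [dnW_add, add_comm 1 a]
    rw [twW_succ' s hc hb, pdW, show a + c - a = c by omega, hQ]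
    calc _ = Q * ((upW s 1 a * upW s (a+1) c) * (dnW s (a+1) c * dnW s 1 a) * upW s 1 a)
            * twW s a := by simp only [mul_assoc]
      _ = pdW s (a+c) a * ((upW s 1 (a+c) * dnW s 1 (a+c)) * twW s a) := by
          rw [e1, e2, hu.eq, hQ]; simp only [mul_assoc]
      _ = _ := by rw [ht.eq, ← mul_assoc, ih (by omega), pow_succ]

lemma final_identity (hc : ∀ i j, i+2 ≤ j → s i * s j = s j * s i)
    (hb : ∀ i, s i * s (i+1) * s i = s (i+1) * s i * s (i+1))
    (N a b : ℕ) (hab : a + 1 + b = N + 1) (hC : ∀ i, 1 ≤ i → i ≤ N →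
    Commute (upW s 1 N * dnW s 1 N) (s i)) :
    upW s 1 a ^ (a+1) * descW s (a+1) b * upW s 1 N * dnW s 1 N * ascW s (a+1) b
      * upW s 1 a ^ (a+1) = (upW s 1 N * dnW s 1 N) ^ (a+1+1) := by
  have h1 : Commute (upW s 1 N * dnW s 1 N) (ascW s (a+1) b) :=
    commute_ascW s _ _ _ fun i h1 h2 => hC i h1 (by omega)
  have h2 : Commute (upW s 1 N * dnW s 1 N) (twW s (a+1)) :=
    commute_twW s _ _ fun i h1 h2 => hC i h1 (by omega)
  rw [← twW_eq s hc hb]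
  calc _ = twW s (a+1) * descW s (a+1) b * ((upW s 1 N * dnW s 1 N) * ascW s (a+1) b)
          * twW s (a+1) := by simp only [mul_assoc]
    _ = twW s (a+1) * (descW s (a+1) b * ascW s (a+1) b)
          * ((upW s 1 N * dnW s 1 N) * twW s (a+1)) := by rw [h1.eq]; simp only [mul_assoc]
    _ = _ := by
      rw [h2.eq, ← pdW_eq s hc hb N (a+1) b hab, ← mul_assoc,
        pdW_mul_twW s hc hb N (a+1) (by omega) hC, ← pow_succ]

end Abstract

/-! ### Transfer to words -/

/-- Generating relations, with the braid relations unrestricted. -/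
inductive BRel (N : ℕ) : FreeMonoid ℕ → FreeMonoid ℕ → Prop
  | comm (i j : ℕ) : i+2 ≤ j → BRel N (FreeMonoid.ofList [i, j]) (FreeMonoid.ofList [j, i])
  | braid (i : ℕ) : BRel N (FreeMonoid.ofList [i, i+1, i]) (FreeMonoid.ofList [i+1, i, i+1])
  | cen (i : ℕ) : 1 ≤ i → i ≤ N → BRel N
      (FreeMonoid.ofList (List.range' 1 N ++ (List.range' 1 N).reverse ++ [i]))
      (FreeMonoid.ofList ([i] ++ List.range' 1 N ++ (List.range' 1 N).reverse))

/-- All entries in range. -/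
def Bdd (N : ℕ) (l : List ℕ) : Prop := ∀ i ∈ l, 1 ≤ i ∧ i ≤ N

lemma bdd_append (N : ℕ) (l₁ l₂ : List ℕ) : Bdd N (l₁ ++ l₂) ↔ Bdd N l₁ ∧ Bdd N l₂ := by
  simp only [Bdd, List.mem_append]
  constructor
  · intro h; exact ⟨fun i hi => h i (Or.inl hi), fun i hi => h i (Or.inr hi)⟩
  · rintro ⟨h1, h2⟩ i (hi | hi)
    · exact h1 i hi
    · exact h2 i hi

lemma nstep_context (g : ℕ) (p q u v : List ℕ) (h : NStep g u v) :
    NStep g (p ++ u ++ q) (p ++ v ++ q) := by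
  cases h with
  | h1 l₁ l₂ i j a b c d e =>
    have := NStep.h1 (g := g) (p ++ l₁) (l₂ ++ q) i j a b c d e
    simpa only [List.append_assoc] using this
  | h2 l₁ l₂ i j a b c d e =>
    have := NStep.h2 (g := g) (p ++ l₁) (l₂ ++ q) i j a b c d e
    simpa only [List.append_assoc] using this
  | h3 l₁ l₂ i a b =>
    have := NStep.h3 (g := g) (p ++ l₁) (l₂ ++ q) i a b
    simpa only [List.append_assoc] using this

lemma eqv_context (g : ℕ) (p q u v : List ℕ) (h : Relation.EqvGen (NStep g) u v) :
    Relation.EqvGen (NStep g) (p ++ u ++ q) (p ++ v ++ q) := by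
  induction h with
  | rel x y h => exact .rel _ _ (nstep_context g p q x y h)
  | refl x => exact .refl _
  | symm x y _ ih => exact .symm _ _ ih
  | trans x y z _ _ ih1 ih2 => exact .trans _ _ _ ih1 ih2

lemma conGen_to_eqv (g : ℕ) (u v : FreeMonoid ℕ) (h : ConGen.Rel (BRel (2*g+1)) u v) :
    (Bdd (2*g+1) u.toList ↔ Bdd (2*g+1) v.toList) ∧
      (Bdd (2*g+1) u.toList → Relation.EqvGen (NStep g) u.toList v.toList) := by
  induction h with
  | of x y h =>
    cases h with
    | comm i j hij =>
      refine ⟨by simp [Bdd]; tauto, fun h => ?_⟩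
      have h1 := h i (by simp)
      have h2 := h j (by simp)
      exact .rel _ _ (by simpa using NStep.h1 (g := g) [] [] i j h1.1 h1.2 h2.1 h2.2 (Or.inl hij))
    | braid i =>
      refine ⟨by simp [Bdd]; tauto, fun h => ?_⟩
      have h1 := h i (by simp)
      have h2 := h (i+1) (by simp)
      exact .rel _ _ (by
        simpa using NStep.h2 (g := g) [] [] i (i+1) h1.1 h1.2 h2.1 h2.2 (Or.inl rfl))
    | cen i h1 h2 =>
      refine ⟨by simp only [FreeMonoid.toList_ofList, bdd_append]; tauto, fun h => ?_⟩
      exact .rel _ _ (by simpa using NStep.h3 (g := g) [] [] i h1 h2)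
  | refl x => exact ⟨Iff.rfl, fun _ => .refl _⟩
  | symm _ ih => exact ⟨ih.1.symm, fun h => .symm _ _ (ih.2 (ih.1.2 h))⟩
  | trans _ _ ih1 ih2 =>
    exact ⟨ih1.1.trans ih2.1, fun h => .trans _ _ _ (ih1.2 h) (ih2.2 (ih1.1.1 h))⟩
  | @mul w x y z _ _ ih1 ih2 =>
    simp only [FreeMonoid.toList_mul, bdd_append]
    refine ⟨and_congr ih1.1 ih2.1, fun h => ?_⟩
    have e1 := eqv_context g [] y.toList _ _ (ih1.2 h.1)
    have e2 := eqv_context g x.toList [] _ _ (ih2.2 h.2)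
    simp only [List.nil_append, List.append_nil] at e1 e2
    exact .trans _ _ _ e1 e2

/-- The image of a letter in the quotient monoid. -/
def genQ (N : ℕ) (i : ℕ) : (conGen (BRel N)).Quotient :=
  ((FreeMonoid.of i : FreeMonoid ℕ) : (conGen (BRel N)).Quotient)

lemma mk_ofList (N : ℕ) (l : List ℕ) :
    ((FreeMonoid.ofList l : FreeMonoid ℕ) : (conGen (BRel N)).Quotient)
      = (l.map (genQ N)).prod := by
  induction l with
  | nil => rfl
  | cons a l ih =>
    rw [FreeMonoid.ofList_cons, Con.coe_mul, ih, List.map_cons, List.prod_cons]; rfl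

lemma eqv_of_prod_eq (g : ℕ) (u v : List ℕ) (hu : Bdd (2*g+1) u)
    (h : (u.map (genQ (2*g+1))).prod = (v.map (genQ (2*g+1))).prod) :
    Relation.EqvGen (NStep g) u v := by
  rw [← mk_ofList, ← mk_ofList, Con.eq] at h
  exact (conGen_to_eqv g _ _ h).2 hu

lemma genQ_rel (N : ℕ) (u v : List ℕ) (h : BRel N (FreeMonoid.ofList u) (FreeMonoid.ofList v)) :
    (u.map (genQ N)).prod = (v.map (genQ N)).prod := by
  rw [← mk_ofList, ← mk_ofList, Con.eq]
  exact ConGen.Rel.of _ _ h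

lemma prod_repL {M : Type*} [Monoid M] (s : ℕ → M) (k : ℕ) (l : List ℕ) :
    ((repL k l).map s).prod = (l.map s).prod ^ k := by
  induction k with
  | zero => simp [repL]
  | succ k ih =>
    have : repL (k+1) l = l ++ repL k l := by simp [repL, List.replicate_succ]
    rw [this, List.map_append, List.prod_append, ih, pow_succ']

lemma prod_asc {M : Type*} [Monoid M] (s : ℕ → M) (a b : ℕ) :
    ((((List.range b).map fun k => List.range' (b-k) a).flatten).map s).prod = ascW s a b := by
  induction b with
  | zero => simp [ascW]
  | succ b ih =>
    rw [List.range_succ_eq_map, List.map_cons, List.flatten_cons, List.map_append,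
      List.prod_append, List.map_map, ascW, ← ih]
    congr 5
    funext k
    simp

lemma prod_desc {M : Type*} [Monoid M] (s : ℕ → M) (a b : ℕ) :
    ((((List.range b).map fun k => (List.range' (k+1) a).reverse).flatten).map s).prod
      = descW s a b := by
  induction b with
  | zero => simp [descW]
  | succ b ih =>
    rw [List.range_succ, List.map_append, List.flatten_append, List.map_append,
      List.prod_append, ih, descW]
    simp [dnW]

lemma eqv_rotate (g : ℕ) (u : List ℕ) (n : ℕ) :
    Relation.EqvGen (fun u v => NStep g u v ∨ v = u.rotate 1) u (u.rotate n) := by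
  induction n with
  | zero => rw [List.rotate_zero]; exact .refl _
  | succ n ih =>
    refine .trans _ _ _ ih (.rel _ _ (Or.inr ?_))
    rw [List.rotate_rotate]

theorem statement5 (g h : ℕ) (hg : 1 ≤ g) (hh1 : 1 ≤ h) (hh2 : h ≤ g/2) :
    Relation.EqvGen (fun u v => NStep g u v ∨ v = u.rotate 1)
      (repL (2*(h+1)) (List.range' 1 (2*g+1) ++ (List.range' 1 (2*g+1)).reverse))
      (w2hSeq g h) := by
  have hrep : repL (4*h+2) (List.range' 1 (2*h))
      = repL (2*h+1) (List.range' 1 (2*h)) ++ repL (2*h+1) (List.range' 1 (2*h)) := by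
    simp only [repL]
    rw [← List.flatten_append, List.replicate_append_replicate]
    congr 2; omega
  have hrot : (w2hSeq g h).rotate ((List.range' 1 (2*g+1)).reverse ++ ascBlocks g h ++
      repL (2*h+1) (List.range' 1 (2*h))).length
      = repL (2*h+1) (List.range' 1 (2*h)) ++ descBlocks g h ++ List.range' 1 (2*g+1) ++
        (List.range' 1 (2*g+1)).reverse ++ ascBlocks g h ++
          repL (2*h+1) (List.range' 1 (2*h)) := by
    have : w2hSeq g h = ((List.range' 1 (2*g+1)).reverse ++ ascBlocks g h ++
      repL (2*h+1) (List.range' 1 (2*h))) ++ (repL (2*h+1) (List.range' 1 (2*h)) ++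
        descBlocks g h ++ List.range' 1 (2*g+1)) := by
      rw [w2hSeq, hrep]; simp only [List.append_assoc]
    rw [this, List.rotate_append_length_eq]; simp only [List.append_assoc]
  have hr := eqv_rotate g (w2hSeq g h) ((List.range' 1 (2*g+1)).reverse ++ ascBlocks g h ++
      repL (2*h+1) (List.range' 1 (2*h))).length
  rw [hrot] at hr
  refine .trans _ _ _ ?_ (.symm _ _ hr)
  refine Relation.EqvGen.mono (r := NStep g) (fun _ _ h => Or.inl h) _ _ ?_
  apply eqv_of_prod_eq
  · intro i hi
    simp only [repL, List.mem_flatten, List.mem_replicate] at hi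
    obtain ⟨l, ⟨_, rfl⟩, hi⟩ := hi
    simp only [List.mem_append, List.mem_reverse, List.mem_range'_1] at hi
    omega
  · have key := final_identity (genQ (2*g+1))
      (fun i j hij => by simpa using genQ_rel (2*g+1) _ _ (BRel.comm i j hij))
      (fun i => by simpa [mul_assoc] using genQ_rel (2*g+1) _ _ (BRel.braid i))
      (2*g+1) (2*h) (2*g-2*h+1) (by omega)
      (fun i h1 h2 => by
        have := genQ_rel (2*g+1) _ _ (BRel.cen i h1 h2)
        simp only [List.map_append, List.prod_append, List.map_cons, List.map_nil,
          List.prod_cons, List.prod_nil, mul_one] at this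
        rw [mul_assoc (genQ _ i)] at this
        exact this)
    simp only [List.map_append, List.prod_append, prod_repL, ascBlocks, descBlocks, prod_asc,
      prod_desc]
    exact key.symm
end

section
/- Let g ≥ 1 and h ≥ 0. The sequence (1, …, 2g+1, 2g+1, …, 1) repeated 2(h+1) times can be transformed by finitely many H3-moves into the sequence ((1, …, 2g+1) repeated 2(h+1) times) ⧺ ((2g+1, …, 1) repeated 2(h+1) times). -/
/-- The H3-move on sequences with entries in {1, …, 2g+1}: replace
(1, …, 2g+1, 2g+1, …, 1, i) by (i, 1, …, 2g+1, 2g+1, …, 1). -/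
inductive H3Step (g : ℕ) : List ℕ → List ℕ → Prop
  | h3 (l₁ l₂ : List ℕ) (i : ℕ) : 1 ≤ i → i ≤ 2*g+1 →
      H3Step g (l₁ ++ (List.range' 1 (2*g+1) ++ (List.range' 1 (2*g+1)).reverse ++ [i]) ++ l₂)
               (l₁ ++ ([i] ++ List.range' 1 (2*g+1) ++ (List.range' 1 (2*g+1)).reverse) ++ l₂)

lemma H3Step.ctx {g : ℕ} {x y : List ℕ} (p : List ℕ) (h : H3Step g x y) :
    H3Step g (p ++ x) (p ++ y) := by
  cases h with
  | h3 l₁ l₂ i h1 h2 =>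
    have := H3Step.h3 (g := g) (p ++ l₁) l₂ i h1 h2
    simpa only [List.append_assoc] using this

lemma h3_ctx {g : ℕ} {x y : List ℕ} (p : List ℕ) (h : Relation.ReflTransGen (H3Step g) x y) :
    Relation.ReflTransGen (H3Step g) (p ++ x) (p ++ y) :=
  Relation.ReflTransGen.lift (fun z => p ++ z) (fun _ _ hab => H3Step.ctx p hab) _ _ h

/-- The block commutes to the right past any word. -/
lemma h3_word (g : ℕ) (w t : List ℕ) (hw : ∀ i ∈ w, 1 ≤ i ∧ i ≤ 2*g+1) :
    Relation.ReflTransGen (H3Step g)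
      (List.range' 1 (2*g+1) ++ ((List.range' 1 (2*g+1)).reverse ++ (w ++ t)))
      (w ++ (List.range' 1 (2*g+1) ++ ((List.range' 1 (2*g+1)).reverse ++ t))) := by
  induction w with
  | nil => exact Relation.ReflTransGen.refl
  | cons i w ih =>
    have hi := hw i (by simp)
    have h1 := H3Step.h3 (g := g) [] (w ++ t) i hi.1 hi.2
    have h2 := h3_ctx [i] (ih (fun j hj => hw j (by simp [hj])))
    simp only [List.append_assoc, List.nil_append, List.cons_append] at h1 h2 ⊢
    exact Relation.ReflTransGen.head h1 h2

lemma repL_succ {α : Type*} (k : ℕ) (w : List α) : repL (k+1) w = w ++ repL k w := by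
  simp [repL, List.replicate_succ]

lemma repL_succ_right {α : Type*} (k : ℕ) (w : List α) : repL (k+1) w = repL k w ++ w := by
  simp [repL, List.replicate_succ']

lemma h3_main (g n : ℕ) :
    Relation.ReflTransGen (H3Step g)
      (repL n (List.range' 1 (2*g+1) ++ (List.range' 1 (2*g+1)).reverse))
      (repL n (List.range' 1 (2*g+1)) ++ repL n ((List.range' 1 (2*g+1)).reverse)) := by
  induction n with
  | zero => exact Relation.ReflTransGen.refl
  | succ n ih =>
    rw [repL_succ, repL_succ_right n (List.range' 1 (2*g+1)),
      repL_succ n (List.range' 1 (2*g+1)).reverse]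
    refine (h3_ctx _ ih).trans ?_
    have := h3_word g (repL n (List.range' 1 (2*g+1)))
      (repL n (List.range' 1 (2*g+1)).reverse) (by
        intro i hi
        simp only [repL, List.mem_flatten, List.mem_replicate] at hi
        obtain ⟨l, ⟨_, rfl⟩, hi⟩ := hi
        rw [List.mem_range'_1] at hi
        omega)
    simpa only [List.append_assoc] using this

theorem statement6 (g h : ℕ) (hg : 1 ≤ g) :
    Relation.ReflTransGen (H3Step g)
      (repL (2*(h+1)) (List.range' 1 (2*g+1) ++ (List.range' 1 (2*g+1)).reverse))
      (repL (2*(h+1)) (List.range' 1 (2*g+1)) ++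
        repL (2*(h+1)) ((List.range' 1 (2*g+1)).reverse)) := by
  exact h3_main g (2*(h+1))
end

section
/- Let n ≥ 1. The sequence (n, n−1, …, 1) repeated n+1 times can be transformed into the sequence (1, 2, …, n) repeated n+1 times by finitely many H1- and H2-moves and their inverses. -/
/-- H1- and H2-moves on sequences with entries in {1, …, N}. -/
inductive BStep (N : ℕ) : List ℕ → List ℕ → Prop
  | h1 (l₁ l₂ : List ℕ) (i j : ℕ) : 1 ≤ i → i ≤ N → 1 ≤ j → j ≤ N →
      (i+2 ≤ j ∨ j+2 ≤ i) →
      BStep N (l₁ ++ [i, j] ++ l₂) (l₁ ++ [j, i] ++ l₂)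
  | h2 (l₁ l₂ : List ℕ) (i j : ℕ) : 1 ≤ i → i ≤ N → 1 ≤ j → j ≤ N →
      (i+1 = j ∨ j+1 = i) →
      BStep N (l₁ ++ [i, j, i] ++ l₂) (l₁ ++ [j, i, j] ++ l₂)


namespace BraidAux

def asc {M : Type*} [Monoid M] (t : ℕ → M) : ℕ → M
  | 0 => 1
  | k+1 => asc t k * t k

def desc {M : Type*} [Monoid M] (t : ℕ → M) (lo : ℕ) : ℕ → M
  | 0 => 1
  | k+1 => t (lo + k) * desc t lo k

structure Rels {M : Type*} [Monoid M] (t : ℕ → M) (n : ℕ) : Prop where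
  braid : ∀ i, i + 1 < n → t i * t (i+1) * t i = t (i+1) * t i * t (i+1)
  comm : ∀ i j, i + 2 ≤ j → j < n → Commute (t i) (t j)

variable {M : Type*} [Monoid M] {t : ℕ → M} {n : ℕ}

theorem comm_asc (h : Rels t n) (j k : ℕ) (hk : k + 1 ≤ j) (hj : j < n) :
    Commute (t j) (asc t k) := by
  induction k with
  | zero => exact Commute.one_right _
  | succ k ih =>
    exact (ih (by omega)).mul_right (h.comm k j (by omega) hj).symm

theorem shift (h : Rels t n) (i m : ℕ) (hi : i + 2 ≤ m) (hm : m ≤ n) :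
    t (i+1) * asc t m = asc t m * t i := by
  induction m, hi using Nat.le_induction with
  | base =>
    have h1 := (comm_asc h (i+1) i le_rfl (by omega)).eq
    have h2 := h.braid i (by omega)
    simp only [asc]
    calc _ = (t (i+1) * asc t i) * (t i * t (i+1)) := by simp only [mul_assoc]
      _ = asc t i * (t (i+1) * t i * t (i+1)) := by rw [h1]; simp only [mul_assoc]
      _ = _ := by rw [← h2]; simp only [mul_assoc]
  | succ m hm' ih =>
    have h1 := (h.comm i m hm' (by omega)).eq
    simp only [asc]
    rw [← mul_assoc, ih (by omega), mul_assoc, h1, mul_assoc]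

theorem desc_shift (h : Rels t n) (lo k m : ℕ) (hi : lo + k + 1 ≤ m) (hm : m ≤ n) :
    desc t (lo+1) k * asc t m = asc t m * desc t lo k := by
  induction k with
  | zero => simp [desc]
  | succ k ih =>
    have h1 := shift h (lo+k) m (by omega) hm
    simp only [desc]
    rw [mul_assoc, ih (by omega), ← mul_assoc, show lo + 1 + k = lo + k + 1 by omega, h1,
      mul_assoc]

theorem asc_pow (h : Rels t n) (m : ℕ) (hm : m + 1 ≤ n) (k : ℕ) : ∀ lo, lo + k = m + 1 →
    asc t (m+1) ^ k = asc t m ^ k * desc t lo k := by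
  induction k with
  | zero => intro lo _; simp [desc]
  | succ k ih =>
    intro lo hlo
    have hk : lo + k = m := by omega
    rw [pow_succ, ih (lo+1) (by omega), mul_assoc, desc_shift h lo k (m+1) (by omega) hm,
      pow_succ]
    simp only [asc, desc, mul_assoc, hk]

theorem asc_full (h : Rels t n) (m : ℕ) (hm : m + 1 ≤ n) :
    asc t (m+1) ^ (m+2) = asc t m ^ (m+1) * desc t 0 (m+1) * asc t (m+1) := by
  rw [pow_succ, asc_pow h m hm (m+1) 0 (by omega)]

open MulOpposite in
theorem Rels.opp (h : Rels t n) : Rels (fun i => op (t i)) n where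
  braid i hi := by
    have := congrArg op (h.braid i hi)
    simpa only [op_mul, mul_assoc] using this
  comm i j hij hj := (h.comm i j hij hj).op

open MulOpposite in
theorem asc_op (k : ℕ) : asc (fun i => op (t i)) k = op (desc t 0 k) := by
  induction k with
  | zero => rfl
  | succ k ih => simp [asc, desc, ih]

theorem desc_zero (k : ℕ) : desc t 0 (k+1) = t k * desc t 0 k := by simp [desc]

open MulOpposite in
theorem desc_op (k : ℕ) : desc (fun i => op (t i)) 0 k = op (asc t k) := by
  induction k with
  | zero => rfl
  | succ k ih => simp [asc, desc, ih]

open MulOpposite in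
theorem desc_full (h : Rels t n) (m : ℕ) (hm : m + 1 ≤ n) :
    desc t 0 (m+1) ^ (m+2) = desc t 0 (m+1) * asc t (m+1) * desc t 0 m ^ (m+1) := by
  have := asc_full h.opp m hm
  rw [asc_op, asc_op, desc_op] at this
  apply op_injective
  simpa only [op_mul, op_pow, mul_assoc] using this

open MulOpposite in
theorem shift' (h : Rels t n) (i m : ℕ) (hi : i + 2 ≤ m) (hm : m ≤ n) :
    desc t 0 m * t (i+1) = t i * desc t 0 m := by
  have := shift h.opp i m hi hm
  rw [asc_op] at this
  apply op_injective
  simpa only [op_mul] using this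

theorem main (h : Rels t n) (m : ℕ) (hm : m ≤ n) :
    desc t 0 m ^ (m+1) = asc t m ^ (m+1) := by
  induction m with
  | zero => simp [desc, asc]
  | succ m ih =>
    have hc : ∀ i, i < m → Commute (desc t 0 (m+1) * asc t (m+1)) (t i) := by
      intro i hi
      show _ * _ = _ * _
      rw [mul_assoc, ← shift h i (m+1) (by omega) hm, ← mul_assoc,
        shift' h i (m+1) (by omega) hm, mul_assoc]
    have hA : ∀ k, k ≤ m → Commute (desc t 0 (m+1) * asc t (m+1)) (asc t k) := by
      intro k hk
      induction k with
      | zero => exact Commute.one_right _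
      | succ k ihk => exact (ihk (by omega)).mul_right (hc k (by omega))
    rw [desc_full h m hm, asc_full h m hm, ih (by omega), ((hA m le_rfl).pow_right (m+1)).eq,
      mul_assoc]

theorem step_append (N : ℕ) {a b : List ℕ} (l r : List ℕ) (h : BStep N a b) :
    BStep N (l ++ a ++ r) (l ++ b ++ r) := by
  cases h with
  | h1 l₁ l₂ i j a1 a2 a3 a4 a5 =>
    have := BStep.h1 (N := N) (l ++ l₁) (l₂ ++ r) i j a1 a2 a3 a4 a5
    simpa only [List.append_assoc] using this
  | h2 l₁ l₂ i j a1 a2 a3 a4 a5 =>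
    have := BStep.h2 (N := N) (l ++ l₁) (l₂ ++ r) i j a1 a2 a3 a4 a5
    simpa only [List.append_assoc] using this

theorem eqv_append (N : ℕ) {a b : List ℕ} (l r : List ℕ) (h : Relation.EqvGen (BStep N) a b) :
    Relation.EqvGen (BStep N) (l ++ a ++ r) (l ++ b ++ r) := by
  induction h with
  | rel _ _ h => exact .rel _ _ (step_append N l r h)
  | refl _ => exact .refl _
  | symm _ _ _ ih => exact .symm _ _ ih
  | trans _ _ _ _ _ ih1 ih2 => exact .trans _ _ _ ih1 ih2

def con (N : ℕ) : Con (FreeMonoid ℕ) where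
  r a b := Relation.EqvGen (BStep N) a.toList b.toList
  iseqv := ⟨fun _ => .refl _, fun h => .symm _ _ h, fun h h' => .trans _ _ _ h h'⟩
  mul' := by
    intro a b c d h1 h2
    have e1 := eqv_append N [] c.toList h1
    have e2 := eqv_append N b.toList [] h2
    simp only [List.nil_append, List.append_nil] at e1 e2
    exact .trans _ _ _ e1 e2

def gen (N : ℕ) (i : ℕ) : (con N).Quotient := ((FreeMonoid.of (i+1) : FreeMonoid ℕ) : (con N).Quotient)

def cls (N : ℕ) (l : List ℕ) : (con N).Quotient := ((FreeMonoid.ofList l : FreeMonoid ℕ) : (con N).Quotient)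

theorem cls_append (N : ℕ) (a b : List ℕ) : cls N (a ++ b) = cls N a * cls N b := rfl

theorem cls_eq (N : ℕ) (a b : List ℕ) : cls N a = cls N b ↔ Relation.EqvGen (BStep N) a b :=
  (con N).eq

theorem gen_rels (N : ℕ) : Rels (gen N) N where
  braid i hi := by
    show cls N [i+1, i+2, i+1] = cls N [i+2, i+1, i+2]
    rw [cls_eq]
    have := BStep.h2 (N := N) [] [] (i+1) (i+2) (by omega) (by omega) (by omega) (by omega)
      (by omega)
    exact .rel _ _ this
  comm i j hij hj := by
    show cls N [i+1, j+1] = cls N [j+1, i+1]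
    rw [cls_eq]
    have := BStep.h1 (N := N) [] [] (i+1) (j+1) (by omega) (by omega) (by omega) (by omega)
      (by omega)
    exact .rel _ _ this

theorem cls_range (N k : ℕ) : cls N (List.range' 1 k) = asc (gen N) k := by
  induction k with
  | zero => rfl
  | succ k ih =>
    rw [List.range'_concat, cls_append, ih, asc, one_mul, Nat.add_comm]
    rfl

theorem cls_range_rev (N k : ℕ) : cls N (List.range' 1 k).reverse = desc (gen N) 0 k := by
  induction k with
  | zero => rfl
  | succ k ih =>
    rw [List.range'_concat, List.reverse_append, cls_append, ih, desc_zero, one_mul, Nat.add_comm]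
    rfl

theorem cls_rep (N k : ℕ) (w : List ℕ) : cls N (repL k w) = cls N w ^ k := by
  induction k with
  | zero => rfl
  | succ k ih =>
    rw [pow_succ', ← ih, ← cls_append]
    simp [repL, List.replicate_succ]

end BraidAux

theorem statement8 (n : ℕ) (hn : 1 ≤ n) :
    Relation.EqvGen (BStep n)
      (repL (n+1) ((List.range' 1 n).reverse))
      (repL (n+1) (List.range' 1 n)) := by
  rw [← BraidAux.cls_eq, BraidAux.cls_rep, BraidAux.cls_rep, BraidAux.cls_range,
    BraidAux.cls_range_rev]
  exact BraidAux.main (BraidAux.gen_rels n) n le_rfl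
end

section
/- Let g ≥ 1. The sequence (1, …, 2g+1, 2g+1, …, 1) repeated 2(g+1) times can be transformed into the sequence (1, …, 2g+1) repeated 4g+4 times by finitely many H1-, H2-, and H3-moves and their inverses. (This is the combinatorial content of the well-known isomorphism (g+1) f_0 ≅ 2 f_1 of fiber sums of the basic Lefschetz fibrations f_0 and f_1.) -/
section Braid

variable {M : Type*} [Monoid M]

/-- `s 1 * … * s n` -/
def upP (s : ℕ → M) : ℕ → M
  | 0 => 1
  | n+1 => upP s n * s (n+1)

/-- `s n * … * s 1` -/
def dnP (s : ℕ → M) : ℕ → M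
  | 0 => 1
  | n+1 => s (n+1) * dnP s n

/-- `s n * s (n-1) * …` (`k` factors) -/
def tlP (s : ℕ → M) : ℕ → ℕ → M
  | _, 0 => 1
  | n, k+1 => s n * tlP s (n-1) k

/-- the braid relations for the indices `1, …, N` -/
structure IsBraid (s : ℕ → M) (N : ℕ) : Prop where
  comm : ∀ i j, 1 ≤ i → i + 2 ≤ j → j ≤ N → s i * s j = s j * s i
  braid : ∀ i, 1 ≤ i → i + 1 ≤ N → s i * s (i+1) * s i = s (i+1) * s i * s (i+1)

variable {s : ℕ → M} {N : ℕ}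

theorem IsBraid.op (h : IsBraid s N) : IsBraid (fun i => MulOpposite.op (s i)) N where
  comm i j h1 h2 h3 := by
    rw [← MulOpposite.op_mul, ← MulOpposite.op_mul, h.comm i j h1 h2 h3]
  braid i h1 h2 := by
    simp only [← MulOpposite.op_mul, ← mul_assoc]
    rw [h.braid i h1 h2]

theorem upP_op (s : ℕ → M) (n : ℕ) :
    upP (fun i => MulOpposite.op (s i)) n = MulOpposite.op (dnP s n) := by
  induction n with
  | zero => rfl
  | succ n ih => simp [upP, dnP, ih]

theorem dnP_op (s : ℕ → M) (n : ℕ) :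
    dnP (fun i => MulOpposite.op (s i)) n = MulOpposite.op (upP s n) := by
  induction n with
  | zero => rfl
  | succ n ih => simp [upP, dnP, ih]

theorem upP_comm (h : IsBraid s N) (n j : ℕ) (hj : n + 2 ≤ j) (hN : j ≤ N) :
    upP s n * s j = s j * upP s n := by
  induction n with
  | zero => simp [upP]
  | succ n ih =>
    rw [upP, mul_assoc, h.comm (n+1) j (by omega) (by omega) hN, ← mul_assoc, ih (by omega),
      mul_assoc]

theorem upP_shift (h : IsBraid s N) (n i : ℕ) (h1 : 1 ≤ i) (hi : i < n) (hn : n ≤ N) :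
    s (i+1) * upP s n = upP s n * s i := by
  induction n with
  | zero => omega
  | succ n ih =>
    rcases Nat.lt_or_ge i n with hlt | hge
    · rw [upP, ← mul_assoc, ih hlt (by omega), mul_assoc, mul_assoc,
        h.comm i (n+1) h1 (by omega) hn]
    · obtain rfl : i = n := by omega
      obtain ⟨m, rfl⟩ : ∃ m, i = m + 1 := ⟨i-1, by omega⟩
      have hb := h.braid (m+1) h1 hn
      have hc := upP_comm h m (m+1+1) (by omega) hn
      simp only [upP]
      calc s (m+1+1) * (upP s m * s (m+1) * s (m+1+1))
          = (s (m+1+1) * upP s m) * s (m+1) * s (m+1+1) := by simp only [mul_assoc]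
        _ = upP s m * (s (m+1+1) * s (m+1) * s (m+1+1)) := by rw [← hc]; simp only [mul_assoc]
        _ = upP s m * s (m+1) * s (m+1+1) * s (m+1) := by rw [← hb]; simp only [mul_assoc]

theorem dnP_shift (h : IsBraid s N) (n i : ℕ) (h1 : 1 ≤ i) (hi : i < n) (hn : n ≤ N) :
    dnP s n * s (i+1) = s i * dnP s n := by
  have := upP_shift h.op n i h1 hi hn
  rw [upP_op, ← MulOpposite.op_mul, ← MulOpposite.op_mul] at this
  exact MulOpposite.op_injective this

theorem tlP_shift (h : IsBraid s N) (n : ℕ) (hn : n ≤ N) (k m : ℕ) (hk : k < m) (hm : m ≤ n) :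
    tlP s m k * upP s n = upP s n * tlP s (m-1) k := by
  induction k generalizing m with
  | zero => simp [tlP]
  | succ k ih =>
    obtain ⟨p, rfl⟩ : ∃ p, m = p + 1 + 1 := ⟨m-2, by omega⟩
    have := ih (p+1) (by omega) (by omega)
    simp only [tlP, Nat.add_sub_cancel] at this ⊢
    rw [mul_assoc, this, ← mul_assoc, upP_shift h n (p+1) (by omega) (by omega) hn, mul_assoc]

theorem tlP_self (n : ℕ) : tlP s n n = dnP s n := by
  induction n with
  | zero => rfl
  | succ n ih => simp [tlP, dnP, ih]

theorem upP_pow (h : IsBraid s N) (n : ℕ) (hn : n + 1 ≤ N) (k : ℕ) (hk : k ≤ n + 1) :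
    upP s (n+1) ^ k = upP s n ^ k * tlP s (n+1) k := by
  induction k with
  | zero => simp [tlP]
  | succ k ih =>
    rw [pow_succ, ih (by omega), mul_assoc, tlP_shift h (n+1) hn k (n+1) (by omega) le_rfl]
    simp only [upP, tlP, Nat.add_sub_cancel, pow_succ, mul_assoc]

theorem upP_full (h : IsBraid s N) (n : ℕ) (hn : n + 1 ≤ N) :
    upP s (n+1) ^ (n+2) = upP s n ^ (n+1) * (dnP s (n+1) * upP s (n+1)) := by
  rw [pow_succ, upP_pow h n hn (n+1) le_rfl, tlP_self, mul_assoc]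

theorem dnP_full (h : IsBraid s N) (n : ℕ) (hn : n + 1 ≤ N) :
    dnP s (n+1) ^ (n+2) = (dnP s (n+1) * upP s (n+1)) * dnP s n ^ (n+1) := by
  have := upP_full h.op n hn
  rw [upP_op, dnP_op, upP_op] at this
  simp only [← MulOpposite.op_mul, ← MulOpposite.op_pow] at this
  exact MulOpposite.op_injective this

theorem upP_commute (c : M) (n : ℕ) (hc : ∀ i, 1 ≤ i → i ≤ n → Commute (s i) c) :
    Commute (upP s n) c := by
  induction n with
  | zero => exact Commute.one_left c
  | succ n ih =>
    exact (ih fun i a b => hc i a (by omega)).mul_left (hc (n+1) (by omega) le_rfl)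

theorem up_eq_dn (h : IsBraid s N) (n : ℕ) (hn : n ≤ N) :
    upP s n ^ (n+1) = dnP s n ^ (n+1) := by
  induction n with
  | zero => simp [upP, dnP]
  | succ n ih =>
    rw [upP_full h n hn, dnP_full h n hn, ← ih (by omega)]
    refine (Commute.pow_left (upP_commute _ n fun i h1 h2 => ?_) (n+1)).eq
    change s i * _ = _ * s i
    rw [← mul_assoc, ← dnP_shift h (n+1) i h1 (by omega) hn, mul_assoc,
      upP_shift h (n+1) i h1 (by omega) hn, mul_assoc]

theorem main_monoid (h : IsBraid s N)
    (hc : ∀ i, 1 ≤ i → i ≤ N → Commute (s i) (upP s N * dnP s N)) :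
    (upP s N * dnP s N) ^ (N+1) = upP s N ^ (2*(N+1)) := by
  have hx := upP_commute _ N hc
  have key : ∀ k, (upP s N * dnP s N) ^ k = upP s N ^ k * dnP s N ^ k := by
    intro k
    induction k with
    | zero => simp
    | succ k ih =>
      rw [pow_succ', ih, ← mul_assoc, ← (hx.pow_left k).eq, pow_succ, pow_succ']
      simp only [mul_assoc]
  rw [key, ← up_eq_dn h N le_rfl, two_mul (N+1), pow_add _ (N+1) (N+1)]

end Braid

theorem NStep.ctx {g : ℕ} {a b : List ℕ} (h : NStep g a b) (u v : List ℕ) :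
    NStep g (u ++ a ++ v) (u ++ b ++ v) := by
  cases h with
  | h1 l₁ l₂ i j a b c d e =>
    simpa using NStep.h1 (g := g) (u ++ l₁) (l₂ ++ v) i j a b c d e
  | h2 l₁ l₂ i j a b c d e =>
    simpa using NStep.h2 (g := g) (u ++ l₁) (l₂ ++ v) i j a b c d e
  | h3 l₁ l₂ i a b =>
    simpa using NStep.h3 (g := g) (u ++ l₁) (l₂ ++ v) i a b

theorem NStep.eqv_ctx {g : ℕ} {a b : List ℕ} (h : Relation.EqvGen (NStep g) a b)
    (u v : List ℕ) : Relation.EqvGen (NStep g) (u ++ a ++ v) (u ++ b ++ v) := by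
  induction h with
  | rel a b h => exact .rel _ _ (h.ctx u v)
  | refl a => exact .refl _
  | symm a b _ ih => exact .symm _ _ ih
  | trans a b c _ _ h1 h2 => exact .trans _ _ _ h1 h2

/-- The congruence generated by the moves. -/
def nCon (g : ℕ) : Con (FreeMonoid ℕ) where
  r a b := Relation.EqvGen (NStep g) a.toList b.toList
  iseqv := ⟨fun _ => .refl _, fun h => .symm _ _ h, fun h k => .trans _ _ _ h k⟩
  mul' {a b c d} h k := by
    have h1 := NStep.eqv_ctx h [] c.toList
    have h2 := NStep.eqv_ctx k b.toList []
    simp only [List.nil_append, List.append_nil] at h1 h2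
    exact .trans _ _ _ h1 h2

/-- The class of a word. -/
def cls (g : ℕ) (l : List ℕ) : (nCon g).Quotient := ((FreeMonoid.ofList l : FreeMonoid ℕ) : (nCon g).Quotient)

theorem cls_eq (g : ℕ) (a b : List ℕ) : cls g a = cls g b ↔ Relation.EqvGen (NStep g) a b :=
  (nCon g).eq

theorem cls_append (g : ℕ) (a b : List ℕ) : cls g (a ++ b) = cls g a * cls g b := rfl

theorem cls_rep (g k : ℕ) (a : List ℕ) : cls g (repL k a) = cls g a ^ k := by
  induction k with
  | zero => rfl
  | succ k ih =>
    rw [pow_succ', ← ih, ← cls_append]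
    simp [repL, List.replicate_succ]

theorem cls_up (g n : ℕ) : cls g (List.range' 1 n) = upP (fun i => cls g [i]) n := by
  induction n with
  | zero => rfl
  | succ n ih => rw [List.range'_concat, cls_append, ih, upP, one_mul, Nat.add_comm 1 n]

theorem cls_dn (g n : ℕ) : cls g (List.range' 1 n).reverse = dnP (fun i => cls g [i]) n := by
  induction n with
  | zero => rfl
  | succ n ih =>
    rw [List.range'_concat, List.reverse_append, cls_append, ih, dnP, one_mul, Nat.add_comm 1 n]
    rfl

theorem cls_braid (g : ℕ) : IsBraid (fun i => cls g [i]) (2*g+1) where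
  comm i j h1 h2 h3 := by
    simp only [← cls_append, cls_eq]
    simpa using Relation.EqvGen.rel _ _
      (NStep.h1 (g := g) [] [] i j h1 (by omega) (by omega) h3 (Or.inl h2))
  braid i h1 h2 := by
    simp only [← cls_append, cls_eq]
    simpa using Relation.EqvGen.rel _ _
      (NStep.h2 (g := g) [] [] i (i+1) h1 (by omega) (by omega) h2 (Or.inl rfl))

theorem statement9 (g : ℕ) (hg : 1 ≤ g) :
    Relation.EqvGen (NStep g)
      (repL (2*(g+1)) (List.range' 1 (2*g+1) ++ (List.range' 1 (2*g+1)).reverse))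
      (repL (4*g+4) (List.range' 1 (2*g+1))) := by
  rw [← cls_eq, cls_rep, cls_rep, cls_append, cls_up, cls_dn]
  have := main_monoid (cls_braid g) (by
    intro i h1 h2
    rw [← cls_up, ← cls_dn]
    change cls g [i] * _ = _ * cls g [i]
    simp only [← cls_append, cls_eq]
    have := Relation.EqvGen.symm _ _ (Relation.EqvGen.rel _ _ (NStep.h3 (g := g) [] [] i h1 h2))
    simpa only [List.nil_append, List.append_nil, List.append_assoc] using this)
  rw [show 2*(g+1) = 2*g+1+1 by ring, show 4*g+4 = 2*(2*g+1+1) by ring]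
  exact this
end
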